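/- arXiv:2212.04327 — 10 statements merged into one kernel-verified Lean document; each statement's English description precedes it below -/
import Mathlib

section
/- For every implicator I, every RIM quantifier Λ, and all crisp subsets A, B ⊆ X, the Choquet integral of I(χ_A, χ_B) with respect to μ_Λ equals Λ((|X∖A| + |A∩B|)/n); i.e., the underlying semi-fuzzy quantifier of Ỹ^I_Λ is Q^→_Λ. -/
attribute [local instance] Classical.propDecidable

/-- A fuzzy set on `X` is a function `X → [0,1]`. -/
def IsFuzzySet {X : Type*} (A : X → ℝ) : Prop := ∀ x, A x ∈ Set.Icc (0:ℝ) 1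

/-- A RIM quantifier: nondecreasing on `[0,1]`, `Λ 0 = 0`, `Λ 1 = 1`. -/
def IsRIM (Λ : ℝ → ℝ) : Prop :=
  MonotoneOn Λ (Set.Icc 0 1) ∧ Λ 0 = 0 ∧ Λ 1 = 1

/-- An implicator `I : [0,1]² → [0,1]`. -/
def IsImplicator (I : ℝ → ℝ → ℝ) : Prop :=
  (∀ x ∈ Set.Icc (0:ℝ) 1, ∀ y ∈ Set.Icc (0:ℝ) 1, I x y ∈ Set.Icc (0:ℝ) 1) ∧
  I 0 0 = 1 ∧ I 0 1 = 1 ∧ I 1 1 = 1 ∧ I 1 0 = 0 ∧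
  (∀ y ∈ Set.Icc (0:ℝ) 1, AntitoneOn (fun x => I x y) (Set.Icc 0 1)) ∧
  (∀ x ∈ Set.Icc (0:ℝ) 1, MonotoneOn (fun y => I x y) (Set.Icc 0 1))

/-- A monotone measure on the finite set `X`. -/
def IsMonotoneMeasure {X : Type*} [Fintype X] (μ : Finset X → ℝ) : Prop :=
  μ ∅ = 0 ∧ μ Finset.univ = 1 ∧ ∀ ⦃S T : Finset X⦄, S ⊆ T → μ S ≤ μ T

/-- The (discrete) Choquet integral of `f` w.r.t. `μ`:
`∑ᵢ f(x*ᵢ) (μ(A*ᵢ) − μ(A*ᵢ₊₁))` where `x*₁,…,x*ₙ` enumerates `X` with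
`f(x*₁) ≤ … ≤ f(x*ₙ)` and `A*ᵢ = {x*ᵢ,…,x*ₙ}`. -/
noncomputable def choquet {X : Type*} [Fintype X] [Nonempty X]
    (μ : Finset X → ℝ) (f : X → ℝ) : ℝ :=
  let l := Finset.univ.toList.mergeSort (fun a b : X => decide (f a ≤ f b))
  ∑ i ∈ Finset.range l.length,
    f (l.getD i (Classical.arbitrary X)) *
      (μ (l.drop i).toFinset - μ (l.drop (i + 1)).toFinset)

/-- The measure `μ_Λ(S) = Λ(|S|/n)`. -/
noncomputable def muLambda {X : Type*} [Fintype X] (Λ : ℝ → ℝ) (S : Finset X) : ℝ :=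
  Λ ((S.card : ℝ) / (Fintype.card X : ℝ))

/-- The measure `μ^A_Λ(S) = Λ(∑_{x∈S} A(x) / |A|_Σ)`. -/
noncomputable def muWeighted {X : Type*} [Fintype X] (Λ : ℝ → ℝ) (A : X → ℝ) (S : Finset X) : ℝ :=
  Λ ((∑ x ∈ S, A x) / ∑ x, A x)

/-- The measure `μ'_Λ(S) = Λ((∑_{j=1}^{|S|} a₍ⱼ₎)/|A|_Σ)`, with `a₍₁₎ ≤ … ≤ a₍ₙ₎`
the values of `A` in nondecreasing order. -/
noncomputable def muPrime {X : Type*} [Fintype X] (Λ : ℝ → ℝ) (A : X → ℝ) (S : Finset X) : ℝ :=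
  Λ ((((Finset.univ.toList.map A).mergeSort (fun a b : ℝ => decide (a ≤ b))).take S.card).sum
      / ∑ x, A x)

theorem choquet_list_aux {X : Type*} (μ : Finset X → ℝ) (f : X → ℝ) (d : X)
    (hf : ∀ x, f x = 0 ∨ f x = 1) (l : List X) (hl : l.Pairwise (fun a b => f a ≤ f b)) :
    ∑ i ∈ Finset.range l.length,
      f (l.getD i d) * (μ (l.drop i).toFinset - μ (l.drop (i + 1)).toFinset) =
    μ (l.toFinset.filter (fun x => f x = 1)) - μ ∅ := by
  induction l with
  | nil => simp
  | cons a t ih =>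
    rw [List.pairwise_cons] at hl
    rw [List.length_cons, Finset.sum_range_succ']
    simp only [List.getD_cons_succ, List.drop_succ_cons, List.getD_cons_zero, List.drop_zero]
    rw [ih hl.2]
    rcases hf a with h | h
    · have : (a :: t).toFinset.filter (fun x => f x = 1) =
          t.toFinset.filter (fun x => f x = 1) := by
        rw [List.toFinset_cons, Finset.filter_insert, if_neg (by rw [h]; norm_num)]
      rw [this, h]; ring
    · have ht : ∀ x ∈ t, f x = 1 := by
        intro x hx
        have h1 := hl.1 x hx
        rcases hf x with h2 | h2
        · rw [h, h2] at h1; norm_num at h1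
        · exact h2
      have e1 : t.toFinset.filter (fun x => f x = 1) = t.toFinset := by
        apply Finset.filter_true_of_mem
        intro x hx
        exact ht x (List.mem_toFinset.1 hx)
      have e2 : (a :: t).toFinset.filter (fun x => f x = 1) = (a :: t).toFinset := by
        rw [List.toFinset_cons, Finset.filter_insert, if_pos h, e1]
      rw [e1, e2, h]; ring

/-- for crisp arguments, `Ỹ^I_Λ(A,B) = Λ((|X∖A| + |A∩B|)/n)`,
i.e. the underlying semi-fuzzy quantifier of `Ỹ^I_Λ` is `Q^→_Λ`. -/
theorem yager_implication_underlying_semifuzzy {X : Type*} [Fintype X] [Nonempty X]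
    (I : ℝ → ℝ → ℝ) (hI : IsImplicator I) (Λ : ℝ → ℝ) (hΛ : IsRIM Λ)
    (A B : Finset X) :
    choquet (muLambda Λ)
        (fun x => I (if x ∈ A then (1:ℝ) else 0) (if x ∈ B then (1:ℝ) else 0)) =
      Λ ((((Finset.univ \ A).card : ℝ) + ((A ∩ B).card : ℝ)) / (Fintype.card X : ℝ)) := by
  obtain ⟨-, h00, h01, h11, h10, -, -⟩ := hI
  set f : X → ℝ :=
    fun x => I (if x ∈ A then (1:ℝ) else 0) (if x ∈ B then (1:ℝ) else 0) with hfdef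
  have hf : ∀ x, f x = 0 ∨ f x = 1 := by
    intro x
    by_cases hA : x ∈ A <;> by_cases hB : x ∈ B <;> simp [hfdef, hA, hB, h00, h01, h11, h10]
  have hs : (Finset.univ.toList.mergeSort
      (fun a b : X => decide (f a ≤ f b))).Pairwise (fun a b => f a ≤ f b) := by
    have := List.pairwise_mergeSort (le := fun a b : X => decide (f a ≤ f b))
      (by intro a b c; simpa using le_trans) (by intro a b; simpa using le_total _ _)
      Finset.univ.toList
    simpa using this
  unfold choquet
  simp only
  rw [choquet_list_aux (muLambda Λ) f _ hf _ hs]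
  have hS : (Finset.univ.toList.mergeSort (fun a b : X => decide (f a ≤ f b))).toFinset.filter
      (fun x => f x = 1) = (Finset.univ \ A) ∪ (A ∩ B) := by
    ext x
    by_cases hA : x ∈ A <;> by_cases hB : x ∈ B <;> simp [hfdef, hA, hB, h00, h01, h11, h10]
  have hd : Disjoint (Finset.univ \ A) (A ∩ B) :=
    Finset.disjoint_of_subset_right Finset.inter_subset_left Finset.sdiff_disjoint
  rw [hS]
  unfold muLambda
  rw [Finset.card_union_of_disjoint hd]
  simp [hΛ.2.1]
end

section
/- For every RIM quantifier Λ and every fuzzy set A on X, F_owa(Q_Λ)(A) equals the Choquet integral of A with respect to the monotone measure μ_Λ(S) = Λ(|S|/n). -/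
attribute [local instance] Classical.propDecidable

/-- The lower bound `A^min_γ` of the three-valued cut of `A` at `γ`. -/
noncomputable def cutMin {X : Type*} [Fintype X] (A : X → ℝ) (γ : ℝ) : Finset X :=
  if 0 < γ then Finset.univ.filter (fun x => (1 + γ) / 2 ≤ A x)
  else Finset.univ.filter (fun x => 1 / 2 < A x)

/-- The upper bound `A^max_γ` of the three-valued cut of `A` at `γ`. -/
noncomputable def cutMax {X : Type*} [Fintype X] (A : X → ℝ) (γ : ℝ) : Finset X :=
  if 0 < γ then Finset.univ.filter (fun x => (1 - γ) / 2 < A x)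
  else Finset.univ.filter (fun x => 1 / 2 ≤ A x)

/-- `F_owa` applied to a unary semi-fuzzy quantifier `Q`:
`∫₀¹ (⊤(γ) + ⊥(γ))/2 dγ` where `⊤(γ)`/`⊥(γ)` are the max/min of `Q(B)` over
`A^min_γ ⊆ B ⊆ A^max_γ`. -/
noncomputable def Fowa1 {X : Type*} [Fintype X] (Q : Finset X → ℝ) (A : X → ℝ) : ℝ :=
  ∫ γ in (0:ℝ)..1,
    (sSup {r : ℝ | ∃ B : Finset X, cutMin A γ ⊆ B ∧ B ⊆ cutMax A γ ∧ Q B = r} +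
     sInf {r : ℝ | ∃ B : Finset X, cutMin A γ ⊆ B ∧ B ⊆ cutMax A γ ∧ Q B = r}) / 2

/-- `F_owa` applied to a binary semi-fuzzy quantifier `Q`. -/
noncomputable def Fowa2 {X : Type*} [Fintype X]
    (Q : Finset X → Finset X → ℝ) (A B : X → ℝ) : ℝ :=
  ∫ γ in (0:ℝ)..1,
    (sSup {r : ℝ | ∃ S T : Finset X, cutMin A γ ⊆ S ∧ S ⊆ cutMax A γ ∧
        cutMin B γ ⊆ T ∧ T ⊆ cutMax B γ ∧ Q S T = r} +
     sInf {r : ℝ | ∃ S T : Finset X, cutMin A γ ⊆ S ∧ S ⊆ cutMax A γ ∧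
        cutMin B γ ⊆ T ∧ T ⊆ cutMax B γ ∧ Q S T = r}) / 2

theorem aux_list {X : Type*} (μ : Finset X → ℝ) (f : X → ℝ) (d : X) (p : X → Prop)
    (hp : ∀ x y, p x → f x ≤ f y → p y) (l : List X)
    (hl : l.Pairwise (fun a b => f a ≤ f b)) :
    ∑ i ∈ Finset.range l.length, (if p (l.getD i d) then (1:ℝ) else 0) *
      (μ (l.drop i).toFinset - μ (l.drop (i + 1)).toFinset)
      = μ (l.toFinset.filter p) - μ ∅ := by
  induction l with
  | nil => simp
  | cons a l ih =>
    rw [List.pairwise_cons] at hl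
    have ih := ih hl.2
    rw [List.length_cons, Finset.sum_range_succ']
    simp only [List.getD_cons_succ, List.drop_succ_cons, List.getD_cons_zero, List.drop_zero]
    rw [ih]
    by_cases ha : p a
    · have h1 : l.toFinset.filter p = l.toFinset := by
        rw [Finset.filter_eq_self]
        intro x hx
        exact hp a x ha (hl.1 x (by simpa using hx))
      have h2 : (a :: l).toFinset.filter p = (a :: l).toFinset := by
        rw [Finset.filter_eq_self]
        intro x hx
        rw [List.mem_toFinset, List.mem_cons] at hx
        rcases hx with rfl | hx
        · exact ha
        · exact hp a x ha (hl.1 x hx)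
      rw [h1, h2, if_pos ha]
      ring
    · have h2 : (a :: l).toFinset.filter p = l.toFinset.filter p := by
        rw [List.toFinset_cons, Finset.filter_insert, if_neg ha]
      rw [h2, if_neg ha]
      ring

theorem aux_int1 (c : ℝ) :
    IntervalIntegrable (fun γ : ℝ => if c < γ then (1:ℝ) else 0) MeasureTheory.volume 0 1 := by
  apply Monotone.intervalIntegrable
  intro x y hxy
  dsimp only
  split_ifs <;> first | (exfalso; linarith) | norm_num

theorem aux_int2 (c : ℝ) :
    IntervalIntegrable (fun γ : ℝ => if γ ≤ c then (1:ℝ) else 0) MeasureTheory.volume 0 1 := by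
  apply Antitone.intervalIntegrable
  intro x y hxy
  dsimp only
  split_ifs <;> first | (exfalso; linarith) | norm_num

theorem aux_val2 (c : ℝ) (h0 : 0 ≤ c) (h1 : c ≤ 1) :
    ∫ γ in (0:ℝ)..1, (if γ ≤ c then (1:ℝ) else 0) = c := by
  have hI := aux_int2 c
  have ha := hI.mono_set (c := 0) (d := c) (by
    rw [Set.uIcc_of_le h0, Set.uIcc_of_le zero_le_one]; exact Set.Icc_subset_Icc le_rfl h1)
  have hb := hI.mono_set (c := c) (d := 1) (by
    rw [Set.uIcc_of_le h1, Set.uIcc_of_le zero_le_one]; exact Set.Icc_subset_Icc h0 le_rfl)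
  rw [← intervalIntegral.integral_add_adjacent_intervals ha hb]
  have e1 : ∫ γ in (0:ℝ)..c, (if γ ≤ c then (1:ℝ) else 0) = ∫ γ in (0:ℝ)..c, (1:ℝ) := by
    apply intervalIntegral.integral_congr_ae
    refine Filter.Eventually.of_forall fun x hx => ?_
    rw [Set.uIoc_of_le h0] at hx
    rw [if_pos hx.2]
  have e2 : ∫ γ in c..(1:ℝ), (if γ ≤ c then (1:ℝ) else 0) = ∫ γ in c..(1:ℝ), (0:ℝ) := by
    apply intervalIntegral.integral_congr_ae
    refine Filter.Eventually.of_forall fun x hx => ?_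
    rw [Set.uIoc_of_le h1] at hx
    rw [if_neg (not_le.2 hx.1)]
  rw [e1, e2]
  simp

theorem aux_val1 (c : ℝ) (h0 : 0 ≤ c) (h1 : c ≤ 1) :
    ∫ γ in (0:ℝ)..1, (if c < γ then (1:ℝ) else 0) = 1 - c := by
  have e : (fun γ : ℝ => if c < γ then (1:ℝ) else 0)
      = fun γ => 1 - (if γ ≤ c then (1:ℝ) else 0) := by
    funext γ
    by_cases h : c < γ
    · rw [if_pos h, if_neg (not_le.2 h)]; ring
    · rw [if_neg h, if_pos (not_lt.1 h)]; ring
  rw [e, intervalIntegral.integral_sub (by simp) (aux_int2 c), aux_val2 c h0 h1]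
  simp

theorem aux_val (a : ℝ) (h0 : 0 ≤ a) (h1 : a ≤ 1) :
    ∫ γ in (0:ℝ)..1, ((if 1 - 2 * a < γ then (1:ℝ) else 0) +
      (if γ ≤ 2 * a - 1 then (1:ℝ) else 0)) = 2 * a := by
  rw [intervalIntegral.integral_add (aux_int1 _) (aux_int2 _)]
  rcases le_total a (1/2) with h | h
  · have e2 : ∫ γ in (0:ℝ)..1, (if γ ≤ 2 * a - 1 then (1:ℝ) else 0) = ∫ γ in (0:ℝ)..1, (0:ℝ) := by
      apply intervalIntegral.integral_congr_ae
      refine Filter.Eventually.of_forall fun x hx => ?_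
      rw [Set.uIoc_of_le zero_le_one] at hx
      rw [if_neg (by have := hx.1; intro h; linarith)]
    rw [e2, aux_val1 _ (by linarith) (by linarith)]
    simp
  · have e1 : ∫ γ in (0:ℝ)..1, (if 1 - 2 * a < γ then (1:ℝ) else 0) = ∫ γ in (0:ℝ)..1, (1:ℝ) := by
      apply intervalIntegral.integral_congr_ae
      refine Filter.Eventually.of_forall fun x hx => ?_
      rw [Set.uIoc_of_le zero_le_one] at hx
      rw [if_pos (by have := hx.1; linarith)]
    rw [e1, aux_val2 _ (by linarith) (by linarith)]
    simp

theorem muLambda_mono {X : Type*} [Fintype X] [Nonempty X] (Λ : ℝ → ℝ) (hΛ : IsRIM Λ)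
    {S T : Finset X} (h : S ⊆ T) : muLambda Λ S ≤ muLambda Λ T := by
  have hn : (0:ℝ) < (Fintype.card X : ℝ) := by exact_mod_cast Fintype.card_pos
  have key : ∀ U : Finset X, (U.card : ℝ) / (Fintype.card X : ℝ) ∈ Set.Icc (0:ℝ) 1 := by
    intro U
    refine ⟨by positivity, ?_⟩
    rw [div_le_one hn]
    exact_mod_cast Finset.card_le_univ U
  apply hΛ.1 (key S) (key T)
  have := Finset.card_le_card h
  gcongr

/-- `F_owa(Q_Λ)(A)` equals the Choquet integral of `A` w.r.t. `μ_Λ`. -/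
theorem Fowa_unary_eq_choquet {X : Type*} [Fintype X] [Nonempty X]
    (Λ : ℝ → ℝ) (hΛ : IsRIM Λ) (A : X → ℝ) (hA : IsFuzzySet A) :
    Fowa1 (fun S : Finset X => Λ ((S.card : ℝ) / (Fintype.card X : ℝ))) A =
      choquet (muLambda Λ) A := by
  change Fowa1 (muLambda Λ) A = _
  unfold Fowa1 choquet
  have hmono := fun {S T : Finset X} (h : S ⊆ T) => muLambda_mono Λ hΛ h
  have hempty : muLambda Λ (∅ : Finset X) = 0 := by simp [muLambda, hΛ.2.1]
  generalize hμ : (muLambda Λ : Finset X → ℝ) = μ at *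
  dsimp only
  set l := (Finset.univ : Finset X).toList.mergeSort (fun a b : X => decide (A a ≤ A b)) with hldef
  have hsort : l.Pairwise (fun a b => A a ≤ A b) := by
    have := List.pairwise_mergeSort (le := fun a b : X => decide (A a ≤ A b))
      (by intro a b c; simpa using fun h1 h2 => le_trans h1 h2)
      (by intro a b; simpa using le_total (A a) (A b)) (Finset.univ.toList)
    simpa using this
  have huniv : l.toFinset = Finset.univ := by
    ext x; simp [l]
  have hl := fun p hp => aux_list μ A (Classical.arbitrary X) p hp l hsort
  simp only [huniv, hempty, sub_zero] at hl
  have step : ∀ γ ∈ Set.uIoc (0:ℝ) 1,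
      (sSup {r : ℝ | ∃ B : Finset X, cutMin A γ ⊆ B ∧ B ⊆ cutMax A γ ∧ μ B = r} +
        sInf {r : ℝ | ∃ B : Finset X, cutMin A γ ⊆ B ∧ B ⊆ cutMax A γ ∧ μ B = r}) / 2
      = ∑ i ∈ Finset.range l.length,
        ((if 1 - 2 * A (l.getD i (Classical.arbitrary X)) < γ then (1:ℝ) else 0) +
          (if γ ≤ 2 * A (l.getD i (Classical.arbitrary X)) - 1 then (1:ℝ) else 0)) *
        ((μ (l.drop i).toFinset - μ (l.drop (i + 1)).toFinset) / 2) := by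
    intro γ hγ
    rw [Set.uIoc_of_le zero_le_one] at hγ
    have hsub : cutMin A γ ⊆ cutMax A γ := by
      intro x hx
      simp only [cutMin, cutMax, if_pos hγ.1, Finset.mem_filter, Finset.mem_univ, true_and] at hx ⊢
      linarith [hγ.1]
    have hs : IsGreatest {r : ℝ | ∃ B : Finset X, cutMin A γ ⊆ B ∧ B ⊆ cutMax A γ ∧ μ B = r}
        (μ (cutMax A γ)) := by
      refine ⟨⟨_, hsub, subset_rfl, rfl⟩, ?_⟩
      rintro r ⟨B, _, h2, rfl⟩
      exact hmono h2
    have hi : IsLeast {r : ℝ | ∃ B : Finset X, cutMin A γ ⊆ B ∧ B ⊆ cutMax A γ ∧ μ B = r}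
        (μ (cutMin A γ)) := by
      refine ⟨⟨_, subset_rfl, hsub, rfl⟩, ?_⟩
      rintro r ⟨B, h1, _, rfl⟩
      exact hmono h1
    rw [hs.csSup_eq, hi.csInf_eq]
    have e1 : cutMax A γ = Finset.univ.filter (fun x => 1 - 2 * A x < γ) := by
      ext x
      simp only [cutMax, if_pos hγ.1, Finset.mem_filter, Finset.mem_univ, true_and]
      constructor <;> intro h <;> linarith
    have e2 : cutMin A γ = Finset.univ.filter (fun x => γ ≤ 2 * A x - 1) := by
      ext x
      simp only [cutMin, if_pos hγ.1, Finset.mem_filter, Finset.mem_univ, true_and]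
      constructor <;> intro h <;> linarith
    have f1 := hl (fun x => 1 - 2 * A x < γ) (by intro x y h1 h2; linarith)
    have f2 := hl (fun x => γ ≤ 2 * A x - 1) (by intro x y h1 h2; linarith)
    have g1 : μ (cutMax A γ) = ∑ i ∈ Finset.range l.length,
        (if 1 - 2 * A (l.getD i (Classical.arbitrary X)) < γ then (1:ℝ) else 0) *
        (μ (l.drop i).toFinset - μ (l.drop (i + 1)).toFinset) := by
      rw [e1]; convert f1.symm
    have g2 : μ (cutMin A γ) = ∑ i ∈ Finset.range l.length,
        (if γ ≤ 2 * A (l.getD i (Classical.arbitrary X)) - 1 then (1:ℝ) else 0) *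
        (μ (l.drop i).toFinset - μ (l.drop (i + 1)).toFinset) := by
      rw [e2]; convert f2.symm
    rw [g1, g2, ← Finset.sum_add_distrib, Finset.sum_div]
    apply Finset.sum_congr rfl
    intro i _
    ring
  rw [intervalIntegral.integral_congr_ae (Filter.Eventually.of_forall step),
    intervalIntegral.integral_finsetSum]
  · apply Finset.sum_congr rfl
    intro i _
    rw [intervalIntegral.integral_mul_const, aux_val _ (hA _).1 (hA _).2]
    ring
  · intro i _
    exact ((aux_int1 _).add (aux_int2 _)).mul_const _
end

section
/- For every implicator I, every RIM quantifier Λ, and all crisp subsets A, B ⊆ X with A nonempty, W̃^I_Λ(χ_A, χ_B) = Λ(|A∩B|/|A|); i.e., the underlying semi-fuzzy quantifier of W̃^I_Λ is Q²_Λ. -/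
attribute [local instance] Classical.propDecidable

theorem choquet_aux {X : Type*} (d : X) (μ : Finset X → ℝ) (f : X → ℝ)
    (hf : ∀ x, f x = 0 ∨ f x = 1) (l : List X) (hl : l.Pairwise (fun a b => f a ≤ f b)) :
    ∑ i ∈ Finset.range l.length,
      f (l.getD i d) * (μ (l.drop i).toFinset - μ (l.drop (i + 1)).toFinset)
      = μ (l.toFinset.filter (fun x => f x = 1)) - μ ∅ := by
  induction l with
  | nil => simp
  | cons a l ih =>
    rw [List.pairwise_cons] at hl
    have ih' := ih hl.2
    rw [List.length_cons, Finset.sum_range_succ']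
    simp only [List.getD_cons_succ, List.drop_succ_cons, List.getD_cons_zero, List.drop_zero]
    rw [ih']
    rcases hf a with h | h
    · rw [h, List.toFinset_cons, Finset.filter_insert, if_neg (by rw [h]; norm_num)]
      ring
    · have h1 : ∀ x ∈ l, f x = 1 := by
        intro x hx
        have h2 := hl.1 x hx
        rcases hf x with h3 | h3
        · rw [h, h3] at h2; norm_num at h2
        · exact h3
      rw [Finset.filter_true_of_mem (s := l.toFinset) (by simpa using h1),
        Finset.filter_true_of_mem (s := (a :: l).toFinset) (by simpa [h] using h1), h]
      ring

/-- for crisp arguments, `W̃^I_Λ(χ_A, χ_B) = Λ(|A∩B|/|A|)`,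
i.e. the underlying semi-fuzzy quantifier of `W̃^I_Λ` is `Q²_Λ`. -/
theorem wowa_underlying_semifuzzy {X : Type*} [Fintype X] [Nonempty X]
    (I : ℝ → ℝ → ℝ) (hI : IsImplicator I) (Λ : ℝ → ℝ) (hΛ : IsRIM Λ)
    (A B : Finset X) (hA : A.Nonempty) :
    choquet (muWeighted Λ (fun x => if x ∈ A then (1:ℝ) else 0))
        (fun x => I (if x ∈ A then (1:ℝ) else 0) (if x ∈ B then (1:ℝ) else 0)) =
      Λ (((A ∩ B).card : ℝ) / (A.card : ℝ)) := by
  obtain ⟨-, h00, h01, h11, h10, -, -⟩ := hI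
  obtain ⟨-, hΛ0, -⟩ := hΛ
  unfold choquet
  dsimp only
  rw [choquet_aux (f := fun x => I (if x ∈ A then (1:ℝ) else 0) (if x ∈ B then (1:ℝ) else 0))]
  · simp only [muWeighted, Finset.sum_empty, zero_div, hΛ0, sub_zero]
    congr 2
    · rw [Finset.sum_boole]
      congr 2
      ext x
      by_cases ha : x ∈ A <;> by_cases hb : x ∈ B <;> simp [ha, hb, h11, h10]
    · simp
  · intro x
    by_cases ha : x ∈ A <;> by_cases hb : x ∈ B <;> simp [ha, hb, h11, h10, h00, h01]
  · have := List.pairwise_mergeSort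
      (le := fun a b : X => decide (I (if a ∈ A then (1:ℝ) else 0) (if a ∈ B then (1:ℝ) else 0)
        ≤ I (if b ∈ A then (1:ℝ) else 0) (if b ∈ B then (1:ℝ) else 0)))
      (by intro a b c h1 h2
          rw [decide_eq_true_eq] at *
          exact h1.trans h2)
      (by intro a b
          rw [Bool.or_eq_true, decide_eq_true_eq, decide_eq_true_eq]
          exact le_total _ _) Finset.univ.toList
    exact this.imp (fun h => by rwa [decide_eq_true_eq] at h)
end

section
/- For every implicator I, every RIM quantifier Λ, and all crisp subsets A, B ⊆ X with A nonempty, Ỹ²_Λ(χ_A, χ_B) = Λ(|A∩B|/|A|); i.e., the underlying semi-fuzzy quantifier of Ỹ²_Λ is Q²_Λ. -/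
attribute [local instance] Classical.propDecidable

theorem aux_perm {X : Type*} [Fintype X] (Z : Finset X) :
    (Finset.univ.toList.map (fun x : X => if x ∈ Z then (0:ℝ) else 1)).Perm
      (List.replicate Z.card 0 ++ List.replicate (Fintype.card X - Z.card) 1) := by
  rw [← Multiset.coe_eq_coe, ← Multiset.map_coe, Finset.coe_toList, ← Multiset.coe_add,
    Multiset.coe_replicate, Multiset.coe_replicate,
    ← Multiset.filter_add_not (fun x => x ∈ Z) (Finset.univ : Finset X).val, Multiset.map_add]
  congr 1
  · rw [Multiset.map_congr rfl (g := fun _ => (0:ℝ)), Multiset.map_const']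
    · congr 1
      rw [← Finset.filter_val, ← Finset.card_def]
      simp
    · intro x hx
      simp at hx
      simp [hx]
  · rw [Multiset.map_congr rfl (g := fun _ => (1:ℝ)), Multiset.map_const']
    · congr 1
      rw [← Finset.filter_val, ← Finset.card_def, ← Finset.card_compl]
      congr 1
      ext x
      simp
    · intro x hx
      simp at hx
      simp [hx]

theorem aux_eq {X : Type*} [Fintype X] (Z : Finset X) (s : List ℝ)
    (hs : s.Pairwise (· ≤ ·))
    (hp : s.Perm (Finset.univ.toList.map (fun x : X => if x ∈ Z then (0:ℝ) else 1))) :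
    s = List.replicate Z.card 0 ++ List.replicate (Fintype.card X - Z.card) 1 := by
  refine (hp.trans (aux_perm Z)).eq_of_pairwise (le := (· ≤ ·)) ?_ hs ?_
  · intro a b _ _ h1 h2
    exact le_antisymm h1 h2
  · rw [List.pairwise_append]
    refine ⟨List.pairwise_replicate.2 (Or.inr le_rfl),
      List.pairwise_replicate.2 (Or.inr le_rfl), ?_⟩
    intro a ha b hb
    rw [List.eq_of_mem_replicate ha, List.eq_of_mem_replicate hb]
    exact zero_le_one

theorem aux_choquet {X : Type*} [Fintype X] [Nonempty X] (μ : Finset X → ℝ) (m : ℕ → ℝ)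
    (hμ : ∀ S, μ S = m S.card) (h0 : m 0 = 0) (Z : Finset X) :
    choquet μ (fun x => if x ∈ Z then (0:ℝ) else 1) = m (Fintype.card X - Z.card) := by
  unfold choquet
  set f : X → ℝ := fun x => if x ∈ Z then (0:ℝ) else 1 with hf
  extract_lets l
  have hperm : l.Perm Finset.univ.toList := List.mergeSort_perm _ _
  have hlen : l.length = Fintype.card X := by
    rw [hperm.length_eq]; simp
  have hnd : l.Nodup := hperm.nodup_iff.2 (Finset.nodup_toList _)
  have hsort : l.Pairwise (fun a b => f a ≤ f b) := by
    have := List.pairwise_mergeSort (le := fun a b : X => decide (f a ≤ f b))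
      (by intro a b c h1 h2
          simp only [decide_eq_true_eq] at *
          exact h1.trans h2)
      (by intro a b
          simpa using le_total (f a) (f b)) Finset.univ.toList
    exact this.imp (by intro a b h; simpa using h)
  have hmap := aux_eq Z (l.map f) (List.pairwise_map.2 hsort) (hperm.map f)
  have hcard : ∀ i, (l.drop i).toFinset.card = Fintype.card X - i := by
    intro i
    rw [List.toFinset_card_of_nodup (hnd.sublist (List.drop_sublist _ _)), List.length_drop, hlen]
  have hZ : Z.card ≤ Fintype.card X := Finset.card_le_univ Z
  have hval : ∀ i, i < Fintype.card X →
      f (l.getD i (Classical.arbitrary X)) = if i < Z.card then 0 else 1 := by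
    intro i hi
    have h1 : f (l.getD i (Classical.arbitrary X)) =
        (l.map f).getD i (f (Classical.arbitrary X)) := by
      rw [List.getD_map]
    rw [h1, hmap, List.getD_eq_getElem _ _ (by simp; omega), List.getElem_append]
    simp only [List.length_replicate, List.getElem_replicate]
    split_ifs <;> rfl
  rw [hlen]
  have hsum : ∀ k, k ≤ Fintype.card X →
      ∑ i ∈ Finset.range k, f (l.getD i (Classical.arbitrary X)) *
        (μ (l.drop i).toFinset - μ (l.drop (i + 1)).toFinset) =
      if k ≤ Z.card then 0 else m (Fintype.card X - Z.card) - m (Fintype.card X - k) := by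
    intro k
    induction k with
    | zero => simp
    | succ k ih =>
      intro hk
      rw [Finset.sum_range_succ, ih (by omega), hval k (by omega), hμ, hμ, hcard, hcard]
      rcases lt_trichotomy k Z.card with h | h | h
      · rw [if_pos h.le, if_pos h, if_pos (by omega)]; ring
      · rw [if_pos h.le, if_neg (by omega), if_neg (by omega), h]; ring
      · rw [if_neg (by omega), if_neg (by omega), if_neg (by omega)]; ring
  rw [hsum _ le_rfl]
  split_ifs with h
  · rw [Nat.sub_eq_zero_of_le h, h0]
  · simp [h0]

/-- for crisp arguments, `Ỹ²_Λ(χ_A, χ_B) = Λ(|A∩B|/|A|)`,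
i.e. the underlying semi-fuzzy quantifier of `Ỹ²_Λ` is `Q²_Λ`. -/
theorem ywi_underlying_semifuzzy {X : Type*} [Fintype X] [Nonempty X]
    (I : ℝ → ℝ → ℝ) (hI : IsImplicator I) (Λ : ℝ → ℝ) (hΛ : IsRIM Λ)
    (A B : Finset X) (hA : A.Nonempty) :
    choquet (muPrime Λ (fun x => if x ∈ A then (1:ℝ) else 0))
        (fun x => I (if x ∈ A then (1:ℝ) else 0) (if x ∈ B then (1:ℝ) else 0)) =
      Λ (((A ∩ B).card : ℝ) / (A.card : ℝ)) := by
  obtain ⟨-, h00, h01, h11, h10, -, -⟩ := hI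
  obtain ⟨-, hΛ0, -⟩ := hΛ
  have hf : (fun x => I (if x ∈ A then (1:ℝ) else 0) (if x ∈ B then (1:ℝ) else 0)) =
      fun x => if x ∈ A \ B then (0:ℝ) else 1 := by
    funext x
    by_cases ha : x ∈ A <;> by_cases hb : x ∈ B <;> simp [ha, hb, h00, h01, h11, h10]
  have hg : (fun x => if x ∈ A then (1:ℝ) else 0) = fun x => if x ∈ Aᶜ then (0:ℝ) else 1 := by
    funext x
    by_cases ha : x ∈ A <;> simp [ha]
  have hsrt : ((Finset.univ.toList.map (fun x => if x ∈ A then (1:ℝ) else 0)).mergeSort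
      (fun a b : ℝ => decide (a ≤ b))) =
      List.replicate Aᶜ.card 0 ++ List.replicate (Fintype.card X - Aᶜ.card) 1 := by
    rw [hg]
    refine aux_eq Aᶜ _ ?_ (List.mergeSort_perm _ _)
    have := List.pairwise_mergeSort (le := fun a b : ℝ => decide (a ≤ b))
      (by intro a b c h1 h2
          simp only [decide_eq_true_eq] at *
          exact h1.trans h2)
      (by intro a b
          simpa using le_total a b)
      (Finset.univ.toList.map (fun x => if x ∈ Aᶜ then (0:ℝ) else 1))
    exact this.imp (by intro a b h; simpa using h)
  have hs : ∑ x, (if x ∈ A then (1:ℝ) else 0) = A.card := by simp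
  rw [hf, aux_choquet _ (fun k => Λ (((List.replicate Aᶜ.card (0:ℝ) ++
    List.replicate (Fintype.card X - Aᶜ.card) 1).take k).sum / (A.card : ℝ)))]
  · have h1 := Finset.card_inter_add_card_sdiff A B
    have h2 : A.card ≤ Fintype.card X := Finset.card_le_univ A
    have h3 := Finset.card_compl A
    simp only [List.take_append, List.take_replicate, List.length_replicate, List.sum_append,
      List.sum_replicate, nsmul_eq_mul, mul_zero, zero_add, mul_one]
    congr 3
    omega
  · intro S
    unfold muPrime
    rw [hsrt, hs]
  · simp [hΛ0]
end

section
/- For every implicator I and all fuzzy sets A, B on X with |A|_Σ > 0, Ỹ²_{Λ_∀}(A,B) = min_{x∈X} I(A(x),B(x)) and Ỹ^I_{Λ_∀}(A,B) = min_{x∈X} I(A(x),B(x)). -/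
attribute [local instance] Classical.propDecidable

theorem choquet_aux_s7 {X : Type*} [Fintype X] [Nonempty X]
    (μ : Finset X → ℝ) (f : X → ℝ) (h1 : ∀ S : Finset X, S.card = Fintype.card X → μ S = 1)
    (h0 : ∀ S : Finset X, S.card < Fintype.card X → μ S = 0) :
    choquet μ f = Finset.univ.inf' Finset.univ_nonempty f := by
  unfold choquet
  have hperm := List.mergeSort_perm (Finset.univ : Finset X).toList
    (fun a b : X => decide (f a ≤ f b))
  have hsort : ((Finset.univ : Finset X).toList.mergeSort
      (fun a b : X => decide (f a ≤ f b))).Pairwise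
      (fun a b => (fun a b : X => decide (f a ≤ f b)) a b = true) := by
    apply List.pairwise_mergeSort
    · intro a b c hab hbc
      simp only [decide_eq_true_eq] at *
      exact hab.trans hbc
    · intro a b
      simp only [Bool.or_eq_true, decide_eq_true_eq]
      exact le_total _ _
  generalize (Finset.univ : Finset X).toList.mergeSort
      (fun a b : X => decide (f a ≤ f b)) = l at hperm hsort
  have hnd : l.Nodup := hperm.nodup_iff.mpr (Finset.nodup_toList _)
  have hlen : l.length = Fintype.card X := by
    rw [hperm.length_eq, Finset.length_toList, Finset.card_univ]
  have hpos : 0 < Fintype.card X := Fintype.card_pos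
  have hmem : ∀ x, x ∈ l := fun x => hperm.mem_iff.mpr (by simp)
  have hcard : ∀ i, (l.drop i).toFinset.card = Fintype.card X - i := by
    intro i
    rw [List.toFinset_card_of_nodup (hnd.sublist (List.drop_sublist _ _)), List.length_drop, hlen]
  show ∑ i ∈ Finset.range l.length, _ = _
  rw [Finset.sum_eq_single 0]
  · rw [h1 _ (by rw [hcard]; omega), h0 _ (by rw [hcard]; omega)]
    cases l with
    | nil => simp at hlen; omega
    | cons a t =>
      simp only [List.getD_cons_zero, sub_zero, mul_one]
      apply le_antisymm
      · apply Finset.le_inf'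
        intro b _
        rcases List.mem_cons.mp (hmem b) with h | h
        · rw [h]
        · simpa using (List.pairwise_cons.mp hsort).1 b h
      · exact Finset.inf'_le _ (Finset.mem_univ a)
  · intro i hi hne
    rw [Finset.mem_range] at hi
    rw [h0 _ (by rw [hcard]; omega), h0 _ (by rw [hcard]; omega)]
    simp
  · intro h
    simp only [Finset.mem_range] at h
    omega

theorem take_sum_lt (l : List ℝ) (hs : l.Pairwise (· ≤ ·)) (h0 : ∀ a ∈ l, 0 ≤ a)
    (hp : 0 < l.sum) (k : ℕ) (hk : k < l.length) : (l.take k).sum < l.sum := by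
  have hsplit : (l.take k).sum + (l.drop k).sum = l.sum := by
    rw [← List.sum_append, List.take_append_drop]
  have hd : 0 ≤ (l.drop k).sum :=
    List.sum_nonneg (fun a ha => h0 a (List.mem_of_mem_drop ha))
  by_contra hcon
  have hz : (l.drop k).sum = 0 := by linarith
  have hdc : l.drop k = l[k] :: l.drop (k+1) := List.drop_eq_getElem_cons hk
  have hd1 : 0 ≤ (l.drop (k+1)).sum :=
    List.sum_nonneg (fun a ha => h0 a (List.mem_of_mem_drop ha))
  have hk0 : l[k] ≤ 0 := by
    rw [hdc, List.sum_cons] at hz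
    linarith
  have ht : (l.take k).sum ≤ 0 := by
    refine (List.sum_le_card_nsmul _ 0 ?_).trans (by simp)
    intro a ha
    have hs' := hs
    rw [← List.take_append_drop k l, List.pairwise_append] at hs'
    exact (hs'.2.2 a ha l[k] (hdc ▸ List.mem_cons_self)).trans hk0
  linarith

/-- with the universal RIM quantifier `Λ_∀`, both `Ỹ²_{Λ_∀}(A,B)` and
`Ỹ^I_{Λ_∀}(A,B)` equal `min_{x∈X} I(A(x),B(x))`. -/
theorem ywi_and_yager_universal {X : Type*} [Fintype X] [Nonempty X]
    (I : ℝ → ℝ → ℝ) (hI : IsImplicator I) (A B : X → ℝ)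
    (hA : IsFuzzySet A) (hB : IsFuzzySet B) (hApos : 0 < ∑ x, A x) :
    choquet (muPrime (fun p => if p = 1 then (1:ℝ) else 0) A) (fun x => I (A x) (B x)) =
      Finset.univ.inf' Finset.univ_nonempty (fun x => I (A x) (B x)) ∧
    choquet (muLambda (X := X) (fun p => if p = 1 then (1:ℝ) else 0))
        (fun x => I (A x) (B x)) =
      Finset.univ.inf' Finset.univ_nonempty (fun x => I (A x) (B x)) := by
  constructor
  · have hperm := List.mergeSort_perm ((Finset.univ : Finset X).toList.map A)
      (fun a b : ℝ => decide (a ≤ b))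
    have hsort : (((Finset.univ : Finset X).toList.map A).mergeSort
        (fun a b : ℝ => decide (a ≤ b))).Pairwise
        (fun a b => (fun a b : ℝ => decide (a ≤ b)) a b = true) := by
      apply List.pairwise_mergeSort
      · intro a b c hab hbc
        simp only [decide_eq_true_eq] at *
        exact hab.trans hbc
      · intro a b
        simp only [Bool.or_eq_true, decide_eq_true_eq]
        exact le_total _ _
    have hsum := hperm.sum_eq
    rw [Finset.sum_map_toList] at hsum
    have hlen := hperm.length_eq
    rw [List.length_map, Finset.length_toList, Finset.card_univ] at hlen
    apply choquet_aux_s7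
    · intro S hS
      unfold muPrime
      rw [hS, ← hlen, List.take_length, hsum, div_self hApos.ne']
      simp
    · intro S hS
      unfold muPrime
      have hlt := take_sum_lt _ (hsort.imp (fun h => by simpa using h))
        (fun a ha => by
          have := hperm.mem_iff.mp ha
          obtain ⟨x, _, rfl⟩ := List.mem_map.mp this
          exact (hA x).1) (by rw [hsum]; exact hApos) S.card (by rw [hlen]; exact hS)
      rw [hsum] at hlt
      exact if_neg ((div_lt_one hApos).mpr hlt).ne
  · have hpos : (0:ℝ) < Fintype.card X := by exact_mod_cast Fintype.card_pos
    apply choquet_aux_s7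
    · intro S hS
      unfold muLambda
      rw [hS, div_self hpos.ne']
      simp
    · intro S hS
      unfold muLambda
      exact if_neg ((div_lt_one hpos).mpr (by exact_mod_cast hS)).ne
end

section
/- For every implicator I and all fuzzy sets A, B on X with |A|_Σ > 0, W̃^I_{Λ_∀}(A,B) = min_{x∈X} I(A(x),B(x)). -/
attribute [local instance] Classical.propDecidable

/-- with the universal RIM quantifier `Λ_∀`,
`W̃^I_{Λ_∀}(A,B) = min_{x∈X} I(A(x),B(x))`. -/
theorem wowa_universal {X : Type*} [Fintype X] [Nonempty X]
    (I : ℝ → ℝ → ℝ) (hI : IsImplicator I) (A B : X → ℝ)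
    (hA : IsFuzzySet A) (hB : IsFuzzySet B) (hApos : 0 < ∑ x, A x) :
    choquet (muWeighted (fun p => if p = 1 then (1:ℝ) else 0) A) (fun x => I (A x) (B x)) =
      Finset.univ.inf' Finset.univ_nonempty (fun x => I (A x) (B x)) := by
  have hf1 : ∀ x, I (A x) (B x) ≤ 1 := fun x => (hI.1 _ (hA x) _ (hB x)).2
  have hf0 : ∀ x, A x = 0 → I (A x) (B x) = 1 := by
    intro x hx
    refine le_antisymm (hf1 x) ?_
    have h := hI.2.2.2.2.2.2 0 (by simp) (by simp : (0:ℝ) ∈ Set.Icc (0:ℝ) 1) (hB x) (hB x).1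
    have h00 := hI.2.1
    rw [hx]
    simp only at h
    linarith
  generalize hf : (fun x => I (A x) (B x)) = f
  have hfx : ∀ x, I (A x) (B x) = f x := fun x => by rw [← hf]
  simp only [hfx] at hf1 hf0
  unfold choquet
  have hperm := List.mergeSort_perm (Finset.univ.toList)
    (fun a b : X => decide (f a ≤ f b))
  have hsort := List.pairwise_mergeSort (le := fun a b : X => decide (f a ≤ f b))
    (by intro a b c; simp only [decide_eq_true_eq]; exact le_trans)
    (by intro a b; simp only [Bool.or_eq_true, decide_eq_true_eq]; exact le_total _ _)
    (Finset.univ.toList)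
  generalize Finset.univ.toList.mergeSort (fun a b : X => decide (f a ≤ f b)) = l at hperm hsort
  have hnd : l.Nodup := hperm.nodup_iff.mpr (Finset.nodup_toList _)
  have hmem : ∀ x, x ∈ l := fun x => hperm.mem_iff.mpr (by simp)
  have huniv : l.toFinset = Finset.univ := by ext x; simp [hmem]
  obtain _ | ⟨a, t⟩ := l
  · exact absurd (hmem (Classical.arbitrary X)) (by simp)
  simp only [decide_eq_true_eq, List.pairwise_cons] at hsort
  have hmin : ∀ x, f a ≤ f x := by
    intro x
    rcases List.mem_cons.mp (hmem x) with h | h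
    · rw [h]
    · exact hsort.1 x h
  have hinf : Finset.univ.inf' Finset.univ_nonempty f = f a :=
    le_antisymm (Finset.inf'_le _ (Finset.mem_univ a)) (Finset.le_inf' _ _ fun x _ => hmin x)
  rw [hinf]
  set μ := muWeighted (fun p => if p = 1 then (1:ℝ) else 0) A with hμ
  have hμ1 : μ Finset.univ = 1 := by
    simp [hμ, muWeighted, div_self hApos.ne']
  have hμ0 : μ ∅ = 0 := by simp [hμ, muWeighted]
  have hμa : 0 < A a → ∀ S : Finset X, a ∉ S → μ S = 0 := by
    intro ha S hS
    have hlt : ∑ x ∈ S, A x < ∑ x, A x :=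
      Finset.sum_lt_sum_of_subset (Finset.subset_univ S) (Finset.mem_univ a) hS ha
        fun x _ _ => (hA x).1
    have : (∑ x ∈ S, A x) / ∑ x, A x ≠ 1 := by
      intro h
      rw [div_eq_one_iff_eq hApos.ne'] at h
      exact hlt.ne h
    simp [hμ, muWeighted, this]
  have hat : a ∉ t := (List.nodup_cons.mp hnd).1
  have hterm : ∀ i ∈ Finset.range (a :: t).length,
      f ((a :: t).getD i (Classical.arbitrary X)) *
        (μ ((a :: t).drop i).toFinset - μ ((a :: t).drop (i + 1)).toFinset) =
      f a * (μ ((a :: t).drop i).toFinset - μ ((a :: t).drop (i + 1)).toFinset) := by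
    intro i _
    rcases (hA a).1.eq_or_lt with h | h
    · have h1 := hf0 a h.symm
      rw [h1, le_antisymm (hf1 _) (h1 ▸ hmin ((a :: t).getD i (Classical.arbitrary X)))]
    · rcases i with _ | i
      · simp
      · have hd : ∀ j, μ ((a :: t).drop (j + 1)).toFinset = 0 := by
          intro j
          apply hμa h
          simp only [List.drop_succ_cons, List.mem_toFinset]
          exact fun hh => hat (List.mem_of_mem_drop hh)
        rw [hd, hd]
        simp
  simp only
  rw [Finset.sum_congr rfl hterm, ← Finset.mul_sum,
    Finset.sum_range_sub' (fun i => μ ((a :: t).drop i).toFinset)]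
  rw [List.drop_length, List.drop_zero, huniv, hμ1, List.toFinset_nil, hμ0]
  ring
end

section
/- For every implicator I and all fuzzy sets A, B on X with |A|_Σ > 0, Ỹ²_{Λ_∃}(A,B) = max_{x ∈ X, A(x) > 0} I(A(x),B(x)) and W̃^I_{Λ_∃}(A,B) = max_{x ∈ X, A(x) > 0} I(A(x),B(x)). -/
attribute [local instance] Classical.propDecidable

theorem aux_sort {X : Type*} [Fintype X] (f : X → ℝ) :
    ∃ l : List X, Finset.univ.toList.mergeSort (fun a b : X => decide (f a ≤ f b)) = l ∧
      l.Nodup ∧ (∀ x, x ∈ l) ∧ l.length = Fintype.card X ∧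
      l.Pairwise (fun a b => f a ≤ f b) := by
  refine ⟨_, rfl, ?_, ?_, ?_, ?_⟩
  · exact (List.mergeSort_perm _ _).nodup_iff.2 (Finset.nodup_toList _)
  · intro x
    simp
  · simp
  · have := List.pairwise_mergeSort (le := fun a b : X => decide (f a ≤ f b))
      (fun a b c => by simpa using le_trans) (fun a b => by simpa using le_total _ _)
      Finset.univ.toList
    simpa using this

theorem aux_choquet_s10 {X : Type*} [Fintype X] [Nonempty X]
    (μ : Finset X → ℝ) (f : X → ℝ) (l : List X)
    (hl : Finset.univ.toList.mergeSort (fun a b : X => decide (f a ≤ f b)) = l)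
    (j : ℕ) (hj : j < l.length)
    (h : ∀ i, μ (l.drop i).toFinset = if i ≤ j then 1 else 0) :
    choquet μ f = f l[j] := by
  unfold choquet
  simp only [hl, h]
  rw [Finset.sum_eq_single j]
  · rw [List.getD_eq_getElem _ _ hj]
    simp
  · intro i _ hij
    have : (i ≤ j) ↔ (i + 1 ≤ j) := by omega
    simp [this]
  · intro h'
    simp at h'
    omega

theorem aux_take (s : List ℝ) (hs : s.Pairwise (· ≤ ·)) (h0 : ∀ x ∈ s, 0 ≤ x) (m : ℕ)
    (hm : m ≤ s.length) : 0 < (s.take m).sum ↔ s.count 0 < m := by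
  have hsplit : s.count 0 = (s.take m).count 0 + (s.drop m).count 0 := by
    rw [← List.count_append, List.take_append_drop]
  have hlen : (s.take m).length = m := by simp [hm]
  have hn : ∀ x ∈ s.take m, 0 ≤ x := fun x hx => h0 x (List.mem_of_mem_take hx)
  constructor
  · intro h
    by_contra hc
    have hex : ∃ x ∈ s.take m, x ≠ 0 := by
      by_contra hne
      push Not at hne
      rw [List.sum_eq_zero hne] at h
      exact lt_irrefl _ h
    obtain ⟨x, hx, hx0⟩ := hex
    have hd : (s.drop m).count 0 = 0 := by
      rw [List.count_eq_zero]
      intro hz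
      rw [← List.take_append_drop m s, List.pairwise_append] at hs
      have := hs.2.2 x hx 0 hz
      exact hx0 (le_antisymm this (hn x hx))
    have h1 : (s.take m).count 0 = (s.take m).length := by
      have := List.count_le_length (a := (0:ℝ)) (l := s.take m)
      omega
    rw [List.count_eq_length] at h1
    exact hx0 (h1 x hx).symm
  · intro h
    by_contra hc
    have hz : (s.take m).sum = 0 := le_antisymm (not_lt.1 hc) (List.sum_nonneg hn)
    have hall : ∀ x ∈ s.take m, x = 0 := fun x hx =>
      le_antisymm (hz ▸ List.single_le_sum hn x hx) (hn x hx)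
    have h1 : (s.take m).count 0 = (s.take m).length := by
      rw [List.count_eq_length]
      intro x hx
      exact (hall x hx).symm
    omega

theorem aux_count {X : Type*} [Fintype X] (A : X → ℝ) :
    ((Finset.univ.toList.map A).mergeSort (fun a b : ℝ => decide (a ≤ b))).count 0 =
      (Finset.univ.filter (fun x => A x = 0)).card := by
  rw [(List.mergeSort_perm _ _).count_eq, Finset.card_def, Finset.filter_val,
    ← Multiset.countP_eq_card_filter, ← Finset.coe_toList, Multiset.coe_countP,
    List.count, List.countP_map]
  congr 1

theorem aux_muPrime {X : Type*} [Fintype X] (A : X → ℝ) (hA : IsFuzzySet A)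
    (hApos : 0 < ∑ x, A x) (S : Finset X) :
    muPrime (fun p => if 0 < p then (1:ℝ) else 0) A S =
      if (Finset.univ.filter (fun x => A x = 0)).card < S.card then 1 else 0 := by
  unfold muPrime
  simp only [div_pos_iff_of_pos_right hApos]
  refine if_congr ?_ rfl rfl
  rw [aux_take, aux_count]
  · have := List.pairwise_mergeSort (le := fun a b : ℝ => decide (a ≤ b))
      (fun a b c => by simpa using le_trans) (fun a b => by simpa using le_total _ _)
      (Finset.univ.toList.map A)
    simpa using this
  · intro x hx
    simp at hx
    obtain ⟨a, rfl⟩ := hx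
    exact (hA a).1
  · simpa using Finset.card_le_univ S

theorem aux_card {X : Type*} (l : List X) (hl : l.Nodup) (i : ℕ) :
    (l.drop i).toFinset.card = l.length - i := by
  rw [List.toFinset_card_of_nodup (hl.sublist (List.drop_sublist _ _)), List.length_drop]

theorem aux_mono {X : Type*} (f : X → ℝ) (l : List X) (hp : l.Pairwise (fun a b => f a ≤ f b))
    (i j : ℕ) (hi : i < l.length) (hj : j < l.length) (hij : i ≤ j) : f l[i] ≤ f l[j] := by
  rcases hij.eq_or_lt with rfl | h
  · exact le_rfl
  · exact List.pairwise_iff_getElem.1 hp i j hi hj h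

theorem aux_mem_drop {X : Type*} (l : List X) (i j : ℕ) (hj : j < l.length) (hij : i ≤ j) :
    l[j] ∈ l.drop i := by
  rw [List.mem_drop_iff_getElem]
  exact ⟨j - i, by omega, by congr 1; omega⟩

theorem aux_of_mem_drop {X : Type*} (l : List X) (i : ℕ) (x : X) (h : x ∈ l.drop i) :
    ∃ j, ∃ hj : j < l.length, i ≤ j ∧ l[j] = x := by
  rw [List.mem_drop_iff_getElem] at h
  obtain ⟨k, hk, rfl⟩ := h
  exact ⟨i + k, by omega, by omega, rfl⟩

/-- with the existential RIM quantifier `Λ_∃`, both `Ỹ²_{Λ_∃}(A,B)` and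
`W̃^I_{Λ_∃}(A,B)` equal `max_{x ∈ X, A(x) > 0} I(A(x),B(x))`. -/
theorem ywi_and_wowa_existential {X : Type*} [Fintype X] [Nonempty X]
    (I : ℝ → ℝ → ℝ) (hI : IsImplicator I) (A B : X → ℝ)
    (hA : IsFuzzySet A) (hB : IsFuzzySet B) (hApos : 0 < ∑ x, A x) :
    choquet (muPrime (fun p => if 0 < p then (1:ℝ) else 0) A) (fun x => I (A x) (B x)) =
      sSup {r : ℝ | ∃ x, 0 < A x ∧ I (A x) (B x) = r} ∧
    choquet (muWeighted (fun p => if 0 < p then (1:ℝ) else 0) A) (fun x => I (A x) (B x)) =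
      sSup {r : ℝ | ∃ x, 0 < A x ∧ I (A x) (B x) = r} := by
  obtain ⟨hr, h00, -, -, -, -, hmono⟩ := hI
  set f : X → ℝ := fun x => I (A x) (B x) with hf
  have hf1 : ∀ x, f x ≤ 1 := fun x => (hr _ (hA x) _ (hB x)).2
  have hf0 : ∀ x, A x = 0 → f x = 1 := by
    intro x hx
    refine le_antisymm (hf1 x) ?_
    have := hmono 0 (by simp) (by simp) (hB x) (hB x).1
    simp only [h00] at this
    simpa [hf, hx] using this
  have hsum : ∃ x, 0 < A x := by
    by_contra hc
    push Not at hc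
    exact absurd hApos (not_lt.2 (Finset.sum_nonpos fun x _ => hc x))
  obtain ⟨l, hl, hnd, hmem, hlen, hp⟩ := aux_sort f
  constructor
  · set Z := Finset.univ.filter (fun x => A x = 0) with hZ
    have hk : Z.card < l.length := by
      obtain ⟨x, hx⟩ := hsum
      rw [hlen]
      refine Finset.card_lt_univ_of_notMem (x := x) ?_
      simp [hZ, hx.ne']
    have hj : l.length - Z.card - 1 < l.length := by omega
    generalize hjd : l.length - Z.card - 1 = j at hj
    rw [aux_choquet_s10 _ f l hl j hj]
    · symm
      have hub : ∀ y, 0 < A y → f y ≤ f l[j] := by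
        intro y hy
        obtain ⟨i, hi, rfl⟩ := List.getElem_of_mem (hmem y)
        rcases le_or_gt i j with hij | hij
        · exact aux_mono f l hp i j hi hj hij
        · by_cases hz : ∃ a, ∃ ha : a < l.length, a ≤ j ∧ A l[a] = 0
          · obtain ⟨a, ha, haj, h0⟩ := hz
            calc f l[i] ≤ 1 := hf1 _
              _ = f l[a] := (hf0 _ h0).symm
              _ ≤ f l[j] := aux_mono f l hp a j ha hj haj
          · exfalso
            have hsub : Z ⊆ (l.drop (j+1)).toFinset := by
              intro z hzZ
              obtain ⟨a, ha, rfl⟩ := List.getElem_of_mem (hmem z)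
              rw [List.mem_toFinset]
              apply aux_mem_drop
              by_contra hlt
              exact hz ⟨a, ha, by omega, by simpa [hZ] using hzZ⟩
            have heq := Finset.eq_of_subset_of_card_le hsub (by rw [aux_card l hnd]; omega)
            have : l[i] ∈ Z := by
              rw [heq, List.mem_toFinset]
              exact aux_mem_drop l _ _ hi hij
            simp [hZ] at this
            exact hy.ne' this
      have hex : ∃ x, 0 < A x ∧ f l[j] ≤ f x := by
        by_contra hc
        push Not at hc
        have hsub : (l.drop j).toFinset ⊆ Z := by
          intro x hx
          rw [List.mem_toFinset] at hx
          obtain ⟨a, ha, hja, rfl⟩ := aux_of_mem_drop l j x hx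
          have h1 : ¬ 0 < A l[a] := fun h => absurd (hc _ h)
            (not_lt.2 (aux_mono f l hp j a hj ha hja))
          simp only [hZ, Finset.mem_filter, Finset.mem_univ, true_and]
          exact le_antisymm (not_lt.1 h1) (hA _).1
        have := Finset.card_le_card hsub
        rw [aux_card l hnd] at this
        omega
      apply IsGreatest.csSup_eq
      constructor
      · obtain ⟨x, hx, hle⟩ := hex
        exact ⟨x, hx, le_antisymm (hub x hx) hle⟩
      · rintro r ⟨x, hx, rfl⟩
        exact hub x hx
    · intro i
      rw [aux_muPrime A hA hApos, aux_card l hnd]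
      have : Z.card < l.length - i ↔ i ≤ j := by omega
      simp only [← hZ, this]
  · have hne : ((Finset.univ : Finset (Fin l.length)).filter (fun i => 0 < A l[i])).Nonempty := by
      obtain ⟨x, hx⟩ := hsum
      obtain ⟨i, hi, rfl⟩ := List.getElem_of_mem (hmem x)
      exact ⟨⟨i, hi⟩, by simpa using hx⟩
    obtain ⟨⟨j, hj⟩, hjm, hmax⟩ := Finset.exists_max_image _ id hne
    have hjA : 0 < A l[j] := by simpa using hjm
    have hmax' : ∀ i, ∀ hi : i < l.length, 0 < A l[i] → i ≤ j := by
      intro i hi h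
      simpa using hmax ⟨i, hi⟩ (by simpa using h)
    rw [aux_choquet_s10 _ f l hl j hj]
    · symm
      apply IsGreatest.csSup_eq
      refine ⟨⟨l[j], hjA, rfl⟩, ?_⟩
      rintro r ⟨x, hx, rfl⟩
      obtain ⟨i, hi, rfl⟩ := List.getElem_of_mem (hmem x)
      exact aux_mono f l hp i j hi hj (hmax' i hi hx)
    · intro i
      unfold muWeighted
      simp only [div_pos_iff_of_pos_right hApos]
      have : 0 < ∑ x ∈ (l.drop i).toFinset, A x ↔ i ≤ j := by
        rw [Finset.sum_pos_iff_of_nonneg (fun x _ => (hA x).1)]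
        constructor
        · rintro ⟨x, hx, hpos⟩
          rw [List.mem_toFinset] at hx
          obtain ⟨a, ha, hja, rfl⟩ := aux_of_mem_drop l i x hx
          exact hja.trans (hmax' a ha hpos)
        · intro hij
          exact ⟨l[j], by rw [List.mem_toFinset]; exact aux_mem_drop l i j hj hij, hjA⟩
      simp only [this]
end

section
/- For every RIM quantifier Λ and all crisp subsets A, B ⊆ X with A nonempty, Λ((|X∖A| + |A∩B|)/n) ≥ Λ(|A∩B|/|A|); i.e., Q^→_Λ(A,B) ≥ Q²_Λ(A,B). -/
attribute [local instance] Classical.propDecidable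

/-- for crisp arguments, `Q^→_Λ(A,B) ≥ Q²_Λ(A,B)`. -/
theorem semifuzzy_implicative_ge_binary {X : Type*} [Fintype X] [Nonempty X]
    (Λ : ℝ → ℝ) (hΛ : IsRIM Λ) (A B : Finset X) (hA : A.Nonempty) :
    Λ ((((Finset.univ \ A).card : ℝ) + ((A ∩ B).card : ℝ)) / (Fintype.card X : ℝ)) ≥
      Λ (((A ∩ B).card : ℝ) / (A.card : ℝ)) := by
  obtain ⟨hmono, -, -⟩ := hΛ
  have hs : (Finset.univ \ A).card + A.card = Fintype.card X := by
    rw [Finset.card_sdiff_add_card_eq_card (Finset.subset_univ A), Finset.card_univ]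
  have hi : (A ∩ B).card ≤ A.card := Finset.card_le_card Finset.inter_subset_left
  have ha : 0 < A.card := hA.card_pos
  rw [← hs]
  generalize (Finset.univ \ A).card = c at *
  generalize (A ∩ B).card = k at *
  generalize A.card = a at *
  have hi' : (k : ℝ) ≤ a := by exact_mod_cast hi
  have ha' : (0 : ℝ) < a := by exact_mod_cast ha
  have hc : (0 : ℝ) ≤ c := Nat.cast_nonneg c
  have hk : (0 : ℝ) ≤ k := Nat.cast_nonneg k
  push_cast
  have hca : (0 : ℝ) < c + a := by linarith
  apply hmono
  · exact ⟨by positivity, (div_le_one ha').2 hi'⟩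
  · exact ⟨by positivity, (div_le_one hca).2 (by linarith)⟩
  · rw [div_le_div_iff₀ ha' hca]
    nlinarith [mul_nonneg hc (sub_nonneg.2 hi')]
end

section
/- For every RIM quantifier Λ, every implicator I, and all fuzzy sets A, B on X with |A|_Σ > 0, Ỹ^I_Λ(A,B) ≥ Ỹ²_Λ(A,B). -/
attribute [local instance] Classical.propDecidable

theorem abel_aux (F d : ℕ → ℝ) (n : ℕ) (hd : ∀ i, 0 ≤ d i) (h0 : 0 ≤ F 0)
    (hF : ∀ i, i + 1 ≤ n → F i ≤ F (i + 1)) :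
    - (F n * d (n + 1)) ≤ ∑ i ∈ Finset.range (n + 1), F i * (d i - d (i + 1)) := by
  induction n with
  | zero => simp; nlinarith [hd 0, mul_nonneg h0 (hd 0)]
  | succ n ih =>
    rw [Finset.sum_range_succ]
    have := ih (fun i hi => hF i (by omega))
    nlinarith [mul_nonneg (sub_nonneg.2 (hF n le_rfl)) (hd (n + 1))]

theorem take_sum_aux (s : List ℝ) (hs : s.Pairwise (· ≤ ·)) (k : ℕ) (hk : k ≤ s.length) :
    (s.take k).sum * s.length ≤ k * s.sum := by
  induction s generalizing k with
  | nil => simp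
  | cons a s ih =>
    rw [List.pairwise_cons] at hs
    cases k with
    | zero => simp
    | succ k =>
      have hk' : k ≤ s.length := by simpa using hk
      have h1 := ih hs.2 k hk'
      have h2 : (s.drop k).length • a ≤ (s.drop k).sum :=
        List.card_nsmul_le_sum _ _ (fun x hx => hs.1 x (List.mem_of_mem_drop hx))
      have h3 := List.sum_take_add_sum_drop s k
      rw [List.length_drop, nsmul_eq_mul, Nat.cast_sub hk'] at h2
      simp only [List.take_succ_cons, List.sum_cons, List.length_cons]
      push_cast
      nlinarith

theorem mu_le_aux {X : Type*} [Fintype X] [Nonempty X]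
    (Λ : ℝ → ℝ) (hΛ : IsRIM Λ) (A : X → ℝ) (hA : IsFuzzySet A) (hApos : 0 < ∑ x, A x)
    (S : Finset X) : muPrime Λ A S ≤ muLambda Λ S := by
  unfold muPrime muLambda
  set s := (Finset.univ.toList.map A).mergeSort (fun a b : ℝ => decide (a ≤ b)) with hs
  have hperm : s.Perm (Finset.univ.toList.map A) := List.mergeSort_perm _ _
  have hsum : s.sum = ∑ x, A x := by
    rw [hperm.sum_eq, Finset.sum_map_toList]
  have hlen : s.length = Fintype.card X := by
    rw [hperm.length_eq]; simp
  have hsort : s.Pairwise (· ≤ ·) := by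
    have := List.pairwise_mergeSort (le := fun a b : ℝ => decide (a ≤ b))
      (by intro a b c; simpa using le_trans) (by intro a b; simpa using le_total a b)
      (Finset.univ.toList.map A)
    simpa using this
  have hk : S.card ≤ s.length := by rw [hlen]; exact Finset.card_le_univ S
  have hn : (0:ℝ) < Fintype.card X := by exact_mod_cast Fintype.card_pos
  have hkr : (S.card : ℝ) ≤ Fintype.card X := by exact_mod_cast Finset.card_le_univ S
  have hnn : ∀ x ∈ s, 0 ≤ x := by
    intro x hx
    rw [hperm.mem_iff] at hx
    simp only [List.mem_map] at hx
    obtain ⟨y, -, rfl⟩ := hx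
    exact (hA y).1
  have hT : 0 ≤ (s.take S.card).sum :=
    List.sum_nonneg (fun x hx => hnn x (List.mem_of_mem_take hx))
  have key := take_sum_aux s hsort S.card hk
  rw [hlen, hsum] at key
  have hle : (s.take S.card).sum / (∑ x, A x) ≤ (S.card : ℝ) / Fintype.card X := by
    rw [div_le_div_iff₀ hApos hn]; exact key
  have h1 : (S.card : ℝ) / Fintype.card X ≤ 1 := (div_le_one hn).2 hkr
  have h0 : 0 ≤ (s.take S.card).sum / (∑ x, A x) := div_nonneg hT hApos.le
  exact hΛ.1 ⟨h0, hle.trans h1⟩ ⟨h0.trans hle, h1⟩ hle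

theorem choquet_mono_aux {X : Type*} [Fintype X] [Nonempty X] (μ ν : Finset X → ℝ) (f : X → ℝ)
    (hf : ∀ x, 0 ≤ f x) (h : ∀ S, ν S ≤ μ S) (he : ν ∅ = μ ∅) :
    choquet ν f ≤ choquet μ f := by
  unfold choquet
  extract_lets l
  have hsort : l.Pairwise (fun a b => f a ≤ f b) := by
    have := List.pairwise_mergeSort (le := fun a b : X => decide (f a ≤ f b))
      (by intro a b c; simpa using le_trans) (by intro a b; simpa using le_total (f a) (f b))
      Finset.univ.toList
    simpa using this
  have hpos : 0 < l.length := by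
    have : l.length = Fintype.card X := by simp [l]
    rw [this]; exact Fintype.card_pos
  obtain ⟨n, hn⟩ : ∃ n, l.length = n + 1 := ⟨l.length - 1, by omega⟩
  have key := abel_aux (fun i => f (l.getD i (Classical.arbitrary X)))
    (fun i => μ (l.drop i).toFinset - ν (l.drop i).toFinset) n
    (fun i => sub_nonneg.2 (h _)) (hf _) (by
      intro i hi
      have h1 : i < l.length := by omega
      have h2 : i + 1 < l.length := by omega
      simp only [List.getD_eq_getElem _ _ h1, List.getD_eq_getElem _ _ h2]
      exact List.pairwise_iff_getElem.1 hsort i (i + 1) h1 h2 (by omega))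
  have hd : l.drop (n + 1) = [] := List.drop_eq_nil_of_le hn.le
  rw [← sub_nonneg, ← Finset.sum_sub_distrib, hn]
  simp only [hd, List.toFinset_nil, he, sub_self, mul_zero, neg_zero] at key
  refine key.trans (le_of_eq (Finset.sum_congr rfl fun i _ => ?_))
  ring

/-- `Ỹ^I_Λ(A,B) ≥ Ỹ²_Λ(A,B)`. -/
theorem yager_ge_ywi {X : Type*} [Fintype X] [Nonempty X]
    (Λ : ℝ → ℝ) (hΛ : IsRIM Λ) (I : ℝ → ℝ → ℝ) (hI : IsImplicator I)
    (A B : X → ℝ) (hA : IsFuzzySet A) (hB : IsFuzzySet B) (hApos : 0 < ∑ x, A x) :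
    choquet (muLambda Λ) (fun x => I (A x) (B x)) ≥
      choquet (muPrime Λ A) (fun x => I (A x) (B x)) := by
  refine choquet_mono_aux _ _ _ (fun x => (hI.1 _ (hA x) _ (hB x)).1)
    (mu_le_aux Λ hΛ A hA hApos) ?_
  simp [muPrime, muLambda]
end

section
/- Let X = {x₁, x₂}, let Λ = id (the identity RIM quantifier), let I = I_KD, let B = χ_{{x₁}}, and let A be the fuzzy set with A(x₁) = 1 and A(x₂) = √2 − 1. Then W̃^{I_KD}_{id}(A,B) − Ỹ^{I_KD}_{id}(A,B) = 3/2 − √2 > 0. In particular, the inequality Ỹ^I_Λ(A,B) ≥ W̃^I_Λ(A,B) does not hold for all fuzzy sets A, B. -/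
attribute [local instance] Classical.propDecidable

theorem choquet_fin_two (μ : Finset (Fin 2) → ℝ) (f : Fin 2 → ℝ) (h : f 1 < f 0) :
    choquet μ f = f 1 * (μ Finset.univ - μ {0}) + f 0 * (μ {0} - μ ∅) := by
  have hl : (Finset.univ : Finset (Fin 2)).toList.mergeSort
      (fun a b : Fin 2 => decide (f a ≤ f b)) = [1, 0] := by
    have hp : ((Finset.univ : Finset (Fin 2)).toList.mergeSort
      (fun a b : Fin 2 => decide (f a ≤ f b))).Perm [1, 0] := by
      refine (List.mergeSort_perm _ _).trans ?_
      rw [List.perm_ext_iff_of_nodup (Finset.nodup_toList _) (by simp)]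
      intro a
      fin_cases a <;> simp
    have hs := List.pairwise_mergeSort (le := fun a b : Fin 2 => decide (f a ≤ f b))
      (by intro a b c; simpa using le_trans) (by intro a b; simpa using le_total _ _)
      (Finset.univ : Finset (Fin 2)).toList
    generalize (Finset.univ : Finset (Fin 2)).toList.mergeSort
      (fun a b : Fin 2 => decide (f a ≤ f b)) = l at hp hs
    have h2 : l.length = 2 := by simpa using hp.length_eq
    obtain ⟨a, b, rfl⟩ := List.length_eq_two.mp h2
    have hab : f a ≤ f b := by simpa using hs
    have hnd : a ≠ b := by simpa using hp.nodup_iff.mpr (by simp)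
    fin_cases a <;> fin_cases b <;> simp at hab hnd ⊢
    exact absurd hab (not_le.mpr h)
  have hu : ([1, 0] : List (Fin 2)).toFinset = Finset.univ := by
    ext a
    fin_cases a <;> simp
  have h0 : ([0] : List (Fin 2)).toFinset = {0} := by
    ext a
    simp
  unfold choquet
  simp only [hl]
  simp only [List.length_cons, List.length_nil, Finset.sum_range_succ, Finset.sum_range_zero,
    List.getD_cons_zero, List.getD_cons_succ, List.drop_zero, List.drop_succ_cons, List.drop_nil,
    zero_add]
  congr! 4 <;> first | (ext a; fin_cases a <;> simp) | simp

/-- on `X = {x₁,x₂}` with `Λ = id`, `I = I_KD`, `B = χ_{{x₁}}`,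
`A(x₁) = 1`, `A(x₂) = √2 − 1`: `W̃^{I_KD}_{id}(A,B) − Ỹ^{I_KD}_{id}(A,B) = 3/2 − √2 > 0`;
in particular `Ỹ^I_Λ(A,B) ≥ W̃^I_Λ(A,B)` fails in general. -/
theorem wowa_can_exceed_yager :
    (choquet (muWeighted (fun p : ℝ => p)
          (fun x : Fin 2 => if x = 0 then (1:ℝ) else Real.sqrt 2 - 1))
        (fun x : Fin 2 => max (1 - (if x = 0 then (1:ℝ) else Real.sqrt 2 - 1))
          (if x = 0 then (1:ℝ) else 0)) -
      choquet (muLambda (X := Fin 2) (fun p : ℝ => p))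
        (fun x : Fin 2 => max (1 - (if x = 0 then (1:ℝ) else Real.sqrt 2 - 1))
          (if x = 0 then (1:ℝ) else 0)) = 3 / 2 - Real.sqrt 2) ∧
    (0 : ℝ) < 3 / 2 - Real.sqrt 2 ∧
    ¬ (∀ A B : Fin 2 → ℝ, IsFuzzySet A → IsFuzzySet B → 0 < ∑ x, A x →
        choquet (muLambda (X := Fin 2) (fun p : ℝ => p))
            (fun x => max (1 - A x) (B x)) ≥
          choquet (muWeighted (fun p : ℝ => p) A) (fun x => max (1 - A x) (B x))) := by
  have h2 : Real.sqrt 2 * Real.sqrt 2 = 2 := Real.mul_self_sqrt (by norm_num)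
  have hlo : 1 < Real.sqrt 2 := by rw [Real.lt_sqrt] <;> norm_num
  have hhi : Real.sqrt 2 < 3 / 2 := by rw [Real.sqrt_lt'] <;> norm_num
  have key : (choquet (muWeighted (fun p : ℝ => p)
          (fun x : Fin 2 => if x = 0 then (1:ℝ) else Real.sqrt 2 - 1))
        (fun x : Fin 2 => max (1 - (if x = 0 then (1:ℝ) else Real.sqrt 2 - 1))
          (if x = 0 then (1:ℝ) else 0)) -
      choquet (muLambda (X := Fin 2) (fun p : ℝ => p))
        (fun x : Fin 2 => max (1 - (if x = 0 then (1:ℝ) else Real.sqrt 2 - 1))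
          (if x = 0 then (1:ℝ) else 0)) = 3 / 2 - Real.sqrt 2) := by
    have hm : max (1 - (Real.sqrt 2 - 1)) 0 = 2 - Real.sqrt 2 := by
      rw [max_eq_left] <;> linarith
    have hlt : (fun x : Fin 2 => max (1 - (if x = 0 then (1:ℝ) else Real.sqrt 2 - 1))
          (if x = 0 then (1:ℝ) else 0)) 1 < (fun x : Fin 2 =>
          max (1 - (if x = 0 then (1:ℝ) else Real.sqrt 2 - 1))
          (if x = 0 then (1:ℝ) else 0)) 0 := by
      simp only [one_ne_zero, if_false, if_true, hm]
      norm_num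
      linarith
    rw [choquet_fin_two _ _ hlt, choquet_fin_two _ _ hlt]
    have hs : Real.sqrt 2 ≠ 0 := by positivity
    have hi : (Real.sqrt 2)⁻¹ = Real.sqrt 2 / 2 := by
      field_simp
      linarith
    simp only [muWeighted, muLambda, one_ne_zero, if_false, if_true, hm, Fin.sum_univ_two,
      Finset.sum_singleton, Finset.sum_empty, Finset.card_univ, Finset.card_singleton,
      Finset.card_empty, Fintype.card_fin]
    rw [show (1 : ℝ) + (Real.sqrt 2 - 1) = Real.sqrt 2 by ring, div_self hs, one_div, hi]
    norm_num
    linarith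
  refine ⟨key, by linarith, fun H => ?_⟩
  have := H (fun x : Fin 2 => if x = 0 then (1:ℝ) else Real.sqrt 2 - 1)
    (fun x : Fin 2 => if x = 0 then (1:ℝ) else 0) ?_ ?_ ?_
  · linarith
  · intro x
    fin_cases x
    · simp
    · simp only [Set.mem_Icc]
      norm_num
  · intro x
    fin_cases x <;> simp
  · simp [Fin.sum_univ_two]
end
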